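/- Let λ = (d-2)/2 and let P_L^{(1+λ,λ)} be Jacobi polynomials. For -1 < a < d, the limit as L → ∞ of L^{-a} ∫_{-1}^{1} P_L^{(1+λ,λ)}(t)² (1-t)^{λ - a/2} (1+t)^λ dt equals 2^{a/2 + d} ∫₀^∞ J_{1+λ}(t)² / t^{1+a} dt, and the latter integral is finite. -/

import Mathlib

open MeasureTheory Real Filter

/-- The Bessel function of the first kind of order `ν`. -/
noncomputable def besselJ (ν x : ℝ) : ℝ :=
  ∑' m : ℕ, (-1) ^ m / (Nat.factorial m * Real.Gamma ((m : ℝ) + ν + 1)) *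
    (x / 2) ^ (2 * (m : ℝ) + ν)

/-- The Jacobi polynomial `P_n^{(α,β)}` in the standard normalization
(`P_n^{(α,β)}(1) = binom(n+α,n)`), given by its explicit expansion around `x = 1`. -/
noncomputable def jacobiP (α β : ℝ) (n : ℕ) (x : ℝ) : ℝ :=
  Real.Gamma (α + n + 1) / (Nat.factorial n * Real.Gamma (α + β + n + 1)) *
    ∑ m ∈ Finset.range (n + 1), (n.choose m : ℝ) *
      Real.Gamma (α + β + n + m + 1) / Real.Gamma (α + m + 1) * ((x - 1) / 2) ^ m


/-- Coefficients of the rescaled Jacobi polynomial. -/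
noncomputable def jE (α : ℝ) (n m : ℕ) : ℝ :=
  (n.choose m : ℝ) * Real.Gamma (2 * α + n + m) / Real.Gamma (2 * α + n) /
    Real.Gamma (α + m + 1) * (-1) ^ m / (n : ℝ) ^ (2 * m)

lemma jE_succ (α : ℝ) (hα : 0 < α) (n m : ℕ) (hn : 0 < n) :
    ((m : ℝ) + 1) * (m + α + 1) * jE α n (m + 1) =
      -(((n : ℝ) - m) * (n + 2 * α + m) / (n : ℝ) ^ 2) * jE α n m := by
  have hn' : (0 : ℝ) < n := by exact_mod_cast hn
  have h1 : Real.Gamma (2 * α + n + (m + 1 : ℕ)) = (2 * α + n + m) * Real.Gamma (2 * α + n + m) := by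
    rw [← Real.Gamma_add_one (by positivity)]; push_cast; ring_nf
  have h2 : Real.Gamma (α + (m + 1 : ℕ) + 1) = (α + m + 1) * Real.Gamma (α + m + 1) := by
    rw [← Real.Gamma_add_one (by positivity)]; push_cast; ring_nf
  have h3 : (n.choose (m + 1) : ℝ) * (m + 1) = n.choose m * (n - m) := by
    rcases le_or_gt m n with h | h
    · have := Nat.choose_succ_right_eq n m
      have h' : ((n - m : ℕ) : ℝ) = n - m := by push_cast [h]; ring
      rw [← h']; exact_mod_cast this
    · rw [Nat.choose_eq_zero_of_lt h, Nat.choose_eq_zero_of_lt (by omega)]; simp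
  have g1 : Real.Gamma (2 * α + n) ≠ 0 := (Real.Gamma_pos_of_pos (by positivity)).ne'
  have g2 : Real.Gamma (α + m + 1) ≠ 0 := (Real.Gamma_pos_of_pos (by positivity)).ne'
  have h4 : (α + m + 1) ≠ 0 := by positivity
  unfold jE
  rw [h1, h2]
  have h5 : (n.choose (m + 1) : ℝ) = n.choose m * (n - m) / (m + 1) := by
    rw [eq_div_iff (by positivity)]; exact h3
  rw [h5]
  field_simp
  ring

lemma jE_zero (α : ℝ) (hα : 0 < α) (n : ℕ) : jE α n 0 = 1 / Real.Gamma (α + 1) := by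
  have g1 : Real.Gamma (2 * α + n) ≠ 0 := (Real.Gamma_pos_of_pos (by positivity)).ne'
  simp [jE, g1]

lemma jE_gt (α : ℝ) (n m : ℕ) (h : n < m) : jE α n m = 0 := by
  simp [jE, Nat.choose_eq_zero_of_lt h]

lemma jE_bound (α : ℝ) (hα : 0 < α) (n m : ℕ) (hn : 0 < n) :
    |jE α n m| ≤ 1 / Real.Gamma (α + 1) * ((2 * α + 2) ^ m / m.factorial) := by
  have g1 : 0 < Real.Gamma (α + 1) := Real.Gamma_pos_of_pos (by positivity)
  have hn' : (1 : ℝ) ≤ n := by exact_mod_cast hn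
  induction m with
  | zero => rw [jE_zero α hα, abs_of_pos (by positivity)]; simp
  | succ m ih =>
    rcases le_or_gt m n with h | h
    · have hm : (m : ℝ) ≤ n := by exact_mod_cast h
      have key := jE_succ α hα n m hn
      have hm0 : (0 : ℝ) ≤ m := by positivity
      have e1 : jE α n (m + 1) =
          -((((n : ℝ) - m) * (n + 2 * α + m) / (n : ℝ) ^ 2) / (((m : ℝ) + 1) * (m + α + 1))) *
            jE α n m := by
        have : (((m : ℝ) + 1) * (m + α + 1)) ≠ 0 := by positivity
        field_simp at key ⊢
        linarith
      have e2 : |-((((n : ℝ) - m) * (n + 2 * α + m) / (n : ℝ) ^ 2) / (((m : ℝ) + 1) * (m + α + 1)))|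
          ≤ (2 * α + 2) / (m + 1) := by
        rw [abs_neg, abs_of_nonneg (by
          have : (0 : ℝ) ≤ n - m := by linarith
          positivity)]
        have : ((n : ℝ) - m) * (n + 2 * α + m) / (n : ℝ) ^ 2 ≤ 2 * α + 2 := by
          rw [div_le_iff₀ (by positivity)]
          have : ((n : ℝ) - m) * (n + 2 * α + m) ≤ n * (n + 2 * α + n) := by
            gcongr <;> linarith
          nlinarith [mul_nonneg hα.le (mul_nonneg (by linarith : (0 : ℝ) ≤ n) (sub_nonneg.2 hn'))]
        gcongr
        nlinarith
      rw [e1, abs_mul]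
      calc _ ≤ (2 * α + 2) / (m + 1) * (1 / Real.Gamma (α + 1) * ((2 * α + 2) ^ m / m.factorial)) := by
            gcongr
        _ = _ := by
            rw [Nat.factorial_succ]; push_cast; field_simp; ring
    · rw [jE_gt α n _ (by omega)]; simp; positivity

lemma jE_tendsto (α : ℝ) (hα : 0 < α) (m : ℕ) :
    Tendsto (fun n : ℕ => jE α n m) atTop
      (nhds ((-1) ^ m / (m.factorial * Real.Gamma (α + m + 1)))) := by
  induction m with
  | zero => simp [jE_zero α hα]
  | succ m ih =>
    have h2 : Real.Gamma (α + (m + 1 : ℕ) + 1) = (α + m + 1) * Real.Gamma (α + m + 1) := by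
      rw [← Real.Gamma_add_one (by positivity)]; push_cast; ring_nf
    have g2 : Real.Gamma (α + m + 1) ≠ 0 := (Real.Gamma_pos_of_pos (by positivity)).ne'
    have hinv : Tendsto (fun n : ℕ => ((n : ℝ))⁻¹) atTop (nhds 0) := tendsto_inv_atTop_nhds_zero_nat
    have t1 : Tendsto (fun n : ℕ => -((1 - m * (n : ℝ)⁻¹) * (1 + (2 * α + m) * (n : ℝ)⁻¹)) /
        (((m : ℝ) + 1) * (m + α + 1)) * jE α n m) atTop
        (nhds (-((1 - m * 0) * (1 + (2 * α + m) * 0)) /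
        (((m : ℝ) + 1) * (m + α + 1)) * ((-1) ^ m / (m.factorial * Real.Gamma (α + m + 1))))) := by
      refine Tendsto.mul (Tendsto.div_const (Tendsto.neg (Tendsto.mul ?_ ?_)) _) ih
      · exact tendsto_const_nhds.sub (hinv.const_mul _)
      · exact tendsto_const_nhds.add (hinv.const_mul _)
    have e : (-((1 - m * 0) * (1 + (2 * α + m) * 0)) /
        (((m : ℝ) + 1) * (m + α + 1)) * ((-1) ^ m / (m.factorial * Real.Gamma (α + m + 1)))) =
        (-1) ^ (m + 1) / ((m + 1).factorial * Real.Gamma (α + (m + 1 : ℕ) + 1)) := by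
      have h4 : (α + m + 1) ≠ 0 := by positivity
      have h4 : ((m:ℝ) + α + 1) ≠ 0 := by positivity
      rw [h2, Nat.factorial_succ]; push_cast; field_simp; ring
    rw [e] at t1
    refine t1.congr' ?_
    filter_upwards [eventually_gt_atTop 0] with n hn
    have key := jE_succ α hα n m hn
    have hn' : (n : ℝ) ≠ 0 := by positivity
    have h5 : (((m : ℝ) + 1) * (m + α + 1)) ≠ 0 := by positivity
    have e1 : jE α n (m + 1) =
          -((((n : ℝ) - m) * (n + 2 * α + m) / (n : ℝ) ^ 2) / (((m : ℝ) + 1) * (m + α + 1))) *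
            jE α n m := by
        field_simp at key ⊢
        linarith
    rw [e1]; field_simp; ring

/-- The rescaled Jacobi polynomial. -/
noncomputable def jQ (α : ℝ) (n : ℕ) : Polynomial ℝ :=
  ∑ m ∈ Finset.range (n + 1), Polynomial.C (jE α n m) * Polynomial.X ^ m

lemma jQ_coeff (α : ℝ) (n m : ℕ) : (jQ α n).coeff m = jE α n m := by
  simp only [jQ, Polynomial.finsetSum_coeff, Polynomial.coeff_C_mul_X_pow]
  rcases lt_or_ge m (n + 1) with h | h
  · simp [h]
  · rw [jE_gt α n m (by omega)]
    apply Finset.sum_eq_zero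
    intro i hi
    rw [Finset.mem_range] at hi
    rw [if_neg (by omega)]

lemma jQ_eval (α : ℝ) (n : ℕ) (s : ℝ) :
    (jQ α n).eval s = ∑ m ∈ Finset.range (n + 1), jE α n m * s ^ m := by
  simp [jQ, Polynomial.eval_finsetSum]

lemma jQ_ode (α : ℝ) (hα : 0 < α) (n : ℕ) (hn : 0 < n) (s : ℝ) :
    s * (1 - s / (n : ℝ) ^ 2) * (jQ α n).derivative.derivative.eval s +
      (α + 1 - (2 * α + 1) * (s / (n : ℝ) ^ 2)) * (jQ α n).derivative.eval s +
      (n * (n + 2 * α) / (n : ℝ) ^ 2) * (jQ α n).eval s = 0 := by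
  have hn' : (n : ℝ) ≠ 0 := by positivity
  set ε : ℝ := 1 / (n : ℝ) ^ 2 with hε
  have : (Polynomial.X * (jQ α n).derivative.derivative
      - Polynomial.C ε * (Polynomial.X * (Polynomial.X * (jQ α n).derivative.derivative))
      + Polynomial.C (α + 1) * (jQ α n).derivative
      - Polynomial.C ((2 * α + 1) * ε) * (Polynomial.X * (jQ α n).derivative)
      + Polynomial.C (n * (n + 2 * α) / (n : ℝ) ^ 2) * jQ α n) = 0 := by
    ext m
    have key := jE_succ α hα n m hn
    simp only [Polynomial.coeff_add, Polynomial.coeff_sub, Polynomial.coeff_C_mul]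
    rcases m with _ | _ | m
    · simp [Polynomial.coeff_derivative, jQ_coeff] at key ⊢
      field_simp at key ⊢
      linarith
    · simp [Polynomial.coeff_derivative, jQ_coeff, Polynomial.coeff_X_mul, hε] at key ⊢
      field_simp at key ⊢
      linarith
    · simp [Polynomial.coeff_derivative, jQ_coeff, Polynomial.coeff_X_mul, hε] at key ⊢
      field_simp at key ⊢
      linarith
  have h2 := congrArg (Polynomial.eval s) this
  simp only [Polynomial.eval_add, Polynomial.eval_sub, Polynomial.eval_mul, Polynomial.eval_C, Polynomial.eval_X, Polynomial.eval_zero] at h2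
  rw [← h2, hε]
  ring

lemma jQ_bound (α : ℝ) (hα : 0 < α) (n : ℕ) (hn : 0 < n) (s R : ℝ) (hs : 0 ≤ s) (hR : s ≤ R) :
    |(jQ α n).eval s| ≤ 1 / Real.Gamma (α + 1) * Real.exp ((2 * α + 2) * R) := by
  have g1 : 0 < Real.Gamma (α + 1) := Real.Gamma_pos_of_pos (by positivity)
  rw [jQ_eval]
  calc _ ≤ ∑ m ∈ Finset.range (n + 1), |jE α n m * s ^ m| := Finset.abs_sum_le_sum_abs _ _
    _ ≤ ∑ m ∈ Finset.range (n + 1), 1 / Real.Gamma (α + 1) * (((2 * α + 2) * s) ^ m / m.factorial) := by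
        apply Finset.sum_le_sum
        intro m _
        rw [abs_mul, abs_of_nonneg (pow_nonneg hs m)]
        calc _ ≤ _ := mul_le_mul_of_nonneg_right (jE_bound α hα n m hn) (pow_nonneg hs m)
          _ = _ := by rw [mul_pow]; ring
    _ ≤ _ := by
        rw [← Finset.mul_sum]
        gcongr
        refine (Real.sum_le_exp_of_nonneg (by positivity) _).trans ?_
        gcongr

lemma jQ_deriv_bound (α : ℝ) (hα : 0 < α) (n : ℕ) (hn : 0 < n) (s : ℝ) (hs : 0 ≤ s) :
    |(jQ α n).derivative.eval s| ≤
      1 / Real.Gamma (α + 1) * (2 * α + 2) * Real.exp ((2 * α + 2) * s) := by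
  have g1 : 0 < Real.Gamma (α + 1) := Real.Gamma_pos_of_pos (by positivity)
  have e : (jQ α n).derivative.eval s = ∑ m ∈ Finset.range n, jE α n (m + 1) * ((m + 1) * s ^ m) := by
    simp only [jQ, Polynomial.derivative_sum, Polynomial.eval_finsetSum]
    rw [Finset.sum_range_succ']
    simp
  rw [e]
  calc _ ≤ ∑ m ∈ Finset.range n, |jE α n (m + 1) * ((m + 1) * s ^ m)| := Finset.abs_sum_le_sum_abs _ _
    _ ≤ ∑ m ∈ Finset.range n, 1 / Real.Gamma (α + 1) * (2 * α + 2) * (((2 * α + 2) * s) ^ m / m.factorial) := by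
        apply Finset.sum_le_sum
        intro m _
        rw [abs_mul, abs_of_nonneg (a := (((m : ℝ) + 1) * s ^ m)) (by positivity)]
        calc _ ≤ _ := mul_le_mul_of_nonneg_right (jE_bound α hα n (m + 1) hn) (by positivity)
          _ = _ := by rw [mul_pow, Nat.factorial_succ]; push_cast; field_simp; ring
    _ ≤ _ := by
        rw [← Finset.mul_sum]
        gcongr
        exact Real.sum_le_exp_of_nonneg (by positivity) _

/-- The limit function. -/
noncomputable def jG (α s : ℝ) : ℝ :=
  ∑' m : ℕ, ((-1) ^ m / (m.factorial * Real.Gamma (α + m + 1))) * s ^ m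

lemma jQ_tendsto (α : ℝ) (hα : 0 < α) (s : ℝ) (hs : 0 ≤ s) :
    Tendsto (fun n : ℕ => (jQ α n).eval s) atTop (nhds (jG α s)) := by
  have e : ∀ n : ℕ, (jQ α n).eval s = ∑' m, jE α n m * s ^ m := by
    intro n
    rw [jQ_eval, tsum_eq_sum]
    intro m hm
    rw [jE_gt α n m (by simpa using hm)]; simp
  simp_rw [e]
  unfold jG
  refine tendsto_tsum_of_dominated_convergence
    (bound := fun m => 1 / Real.Gamma (α + 1) * (((2 * α + 2) * s) ^ m / m.factorial)) ?_ ?_ ?_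
  · exact (Real.summable_pow_div_factorial _).mul_left _
  · intro m
    exact (jE_tendsto α hα m).mul_const _
  · filter_upwards [eventually_gt_atTop 0] with n hn m
    rw [Real.norm_eq_abs, abs_mul, abs_of_nonneg (pow_nonneg hs m)]
    calc _ ≤ _ := mul_le_mul_of_nonneg_right (jE_bound α hα n m hn) (pow_nonneg hs m)
      _ = _ := by rw [mul_pow]; ring

/-- Bracket in the virial functional. -/
noncomputable def jB (α b ε Λ s y y1 : ℝ) : ℝ :=
  s ^ 2 * (1 - ε * s) * y1 ^ 2 + Λ * s * y ^ 2 +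
    s * ((α + 1 + b / 2) - (2 * α + b / 2) * (ε * s)) * (y * y1) +
    1 / 2 * ((α + 1 + b / 2) * (b / 2 + 1) - (2 * α + b / 2) * (b / 2) * (ε * s)) * y ^ 2

/-- Lower order term. -/
noncomputable def jq (α b x : ℝ) : ℝ :=
  1 / 2 * (((α - 1 - b / 2) * (1 - x) - α * x) *
    ((α + 1 + b / 2) * (b / 2 + 1) - (2 * α + b / 2) * (b / 2) * x) -
      x * (1 - x) * ((2 * α + b / 2) * (b / 2)))

lemma Phi_deriv (α b ε Λ : ℝ) (g g1 g2 : ℝ → ℝ) (s : ℝ) (hs : 0 < s) (hx : ε * s < 1)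
    (h1 : HasDerivAt g (g1 s) s) (h2 : HasDerivAt g1 (g2 s) s)
    (ode : s * (1 - ε * s) * g2 s + (α + 1 - (2 * α + 1) * (ε * s)) * g1 s + Λ * g s = 0) :
    HasDerivAt (fun s => -(s ^ (α - 1 - b / 2) * (1 - ε * s) ^ α * jB α b ε Λ s (g s) (g1 s)))
      (s ^ (α - 1 - b / 2 - 1) * (1 - ε * s) ^ (α - 1) * g s ^ 2 *
        (Λ * (1 + b * (1 - ε * s)) * s - jq α b (ε * s))) s := by
  have hid := hasDerivAt_id s
  have hε : HasDerivAt (fun s => ε * s) ε s := by simpa using hid.const_mul ε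
  have hε1 : HasDerivAt (fun s => 1 - ε * s) (-ε) s := by simpa using hε.const_sub 1
  have hp1 : HasDerivAt (fun s => s ^ (α - 1 - b / 2)) ((α - 1 - b / 2) * s ^ (α - 1 - b / 2 - 1)) s :=
    Real.hasDerivAt_rpow_const (Or.inl hs.ne')
  have hp2 : HasDerivAt (fun s => (1 - ε * s) ^ α) (-ε * α * (1 - ε * s) ^ (α - 1)) s :=
    hε1.rpow_const (Or.inl (by linarith))
  have hB := ((((hid.pow 2).mul hε1).mul (h2.pow 2)).add ((hid.const_mul Λ).mul (h1.pow 2))).add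
    ((hid.mul ((hε.const_mul (2 * α + b / 2)).const_sub (α + 1 + b / 2))).mul (h1.mul h2)) |>.add
    ((((hε.const_mul ((2 * α + b / 2) * (b / 2))).const_sub
      ((α + 1 + b / 2) * (b / 2 + 1))).const_mul (1 / 2)).mul (h1.pow 2))
  have hΦ := ((hp1.mul hp2).mul hB).neg
  refine (hΦ.congr_deriv ?_)
  have e1 : s ^ (α - 1 - b / 2) = s ^ (α - 1 - b / 2 - 1) * s := by
    rw [← Real.rpow_add_one hs.ne']; ring_nf
  have e2 : (1 - ε * s) ^ α = (1 - ε * s) ^ (α - 1) * (1 - ε * s) := by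
    rw [← Real.rpow_add_one (by linarith)]; ring_nf
  simp only [Pi.mul_apply, Pi.add_apply, Pi.pow_apply, id, Nat.cast_ofNat, e1, e2, jq]
  generalize s ^ (α - 1 - b / 2 - 1) = S
  generalize (1 - ε * s) ^ (α - 1) = T
  linear_combination (-(S * T * s * (2 * s * (1 - ε * s) * g1 s + ((α + 1 + b / 2) - (2 * α + b / 2) * (ε * s)) * g s))) * ode

lemma lim_core (F : ℕ → ℝ → ℝ) (G : ℝ → ℝ)
    (hF : ∀ n s, 0 < s → 0 ≤ F n s) (hG0 : ∀ s, 0 < s → 0 ≤ G s)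
    (hFi : ∀ᶠ n in atTop, IntegrableOn (F n) (Set.Ioi 0))
    (hG : ∀ R, 0 < R → IntegrableOn G (Set.Ioc 0 R))
    (conv : ∀ R, 0 < R → Tendsto (fun n => ∫ s in Set.Ioc 0 R, F n s) atTop
      (nhds (∫ s in Set.Ioc 0 R, G s)))
    (tail : ∀ δ > 0, ∃ R0 > 0, ∀ R ≥ R0, ∀ᶠ n in atTop, ∫ s in Set.Ioi R, F n s ≤ δ) :
    IntegrableOn G (Set.Ioi 0) ∧
      Tendsto (fun n => ∫ s in Set.Ioi 0, F n s) atTop (nhds (∫ s in Set.Ioi 0, G s)) := by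
  have hsplit : ∀ (f : ℝ → ℝ), IntegrableOn f (Set.Ioi 0) → ∀ R, 0 < R →
      ∫ s in Set.Ioi 0, f s = (∫ s in Set.Ioc 0 R, f s) + ∫ s in Set.Ioi R, f s := by
    intro f hf R hR
    rw [← setIntegral_union (Set.Ioc_disjoint_Ioi le_rfl) measurableSet_Ioi
      (hf.mono_set Set.Ioc_subset_Ioi_self) (hf.mono_set (Set.Ioi_subset_Ioi hR.le)),
      Set.Ioc_union_Ioi_eq_Ioi hR.le]
  have hint : IntegrableOn G (Set.Ioi 0) := by
    obtain ⟨R0, hR0, ht⟩ := tail 1 one_pos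
    refine integrableOn_Ioi_of_intervalIntegral_norm_bounded (l := atTop)
      (b := fun i : ℕ => (i : ℝ) + 1) ((∫ s in Set.Ioc 0 R0, G s) + 1) 0
      (fun i => hG _ (by positivity))
      (tendsto_atTop_add_const_right _ _ tendsto_natCast_atTop_atTop) ?_
    refine Eventually.of_forall fun i => ?_
    have hi : (0 : ℝ) < i + 1 := by positivity
    rw [intervalIntegral.integral_of_le hi.le]
    have e : ∫ x in Set.Ioc 0 ((i : ℝ) + 1), ‖G x‖ = ∫ x in Set.Ioc 0 ((i : ℝ) + 1), G x :=
      setIntegral_congr_fun measurableSet_Ioc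
        fun x hx => by simp only [Real.norm_eq_abs]; exact abs_of_nonneg (hG0 x hx.1)
    rw [e]
    refine le_of_tendsto_of_tendsto (conv _ hi) ((conv R0 hR0).add_const 1) ?_
    filter_upwards [ht R0 le_rfl, hFi] with n hn hni
    have h1 := hsplit _ hni R0 hR0
    have h2 : ∫ s in Set.Ioc 0 ((i : ℝ) + 1), F n s ≤ ∫ s in Set.Ioi 0, F n s :=
      setIntegral_mono_set hni (by
        filter_upwards [ae_restrict_mem measurableSet_Ioi] with s hs using hF n s hs)
        (Set.Ioc_subset_Ioi_self).eventuallyLE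
    linarith
  refine ⟨hint, ?_⟩
  rw [Metric.tendsto_atTop']
  intro δ hδ
  obtain ⟨R0, hR0, ht⟩ := tail (δ / 4) (by positivity)
  have hGt : Tendsto (fun R : ℝ => ∫ s in Set.Ioc 0 R, G s) atTop (nhds (∫ s in Set.Ioi 0, G s)) := by
    have := intervalIntegral_tendsto_integral_Ioi 0 hint tendsto_id
    refine this.congr' ?_
    filter_upwards [eventually_ge_atTop 0] with R hR
    exact intervalIntegral.integral_of_le hR
  obtain ⟨R, hR, hRR⟩ := ((eventually_ge_atTop R0).and
    (hGt.eventually (Metric.ball_mem_nhds _ (by positivity : 0 < δ / 4)))).exists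
  have hRp : 0 < R := lt_of_lt_of_le hR0 hR
  have hev : ∀ᶠ n in atTop, dist (∫ s in Set.Ioi 0, F n s) (∫ s in Set.Ioi 0, G s) < δ := by
    filter_upwards [ht R hR, hFi, (conv R hRp).eventually
      (Metric.ball_mem_nhds _ (by positivity : 0 < δ / 4))] with n h1 h2 h3
    have h4 := hsplit _ h2 R hRp
    have h5 : 0 ≤ ∫ s in Set.Ioi R, F n s :=
      setIntegral_nonneg measurableSet_Ioi fun s hs => hF n s (hRp.trans hs)
    rw [Real.dist_eq, abs_lt] at hRR h3
    rw [Real.dist_eq, abs_lt]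
    constructor <;> linarith [hRR.1, hRR.2, h3.1, h3.2]
  obtain ⟨n0, hn0⟩ := eventually_atTop.1 hev
  exact ⟨n0, fun n hn => hn0 n hn.le⟩

/-- The rescaled integrand. -/
noncomputable def jf (α b : ℝ) (n : ℕ) (s : ℝ) : ℝ :=
  (jQ α n).eval s ^ 2 * (s ^ (α - 1 - b / 2) * (1 - ((n : ℝ) ^ 2)⁻¹ * s) ^ (α - 1))

lemma jf_meas (α b : ℝ) (n : ℕ) : Measurable (jf α b n) := by
  unfold jf
  have : Measurable fun s => (jQ α n).eval s := (jQ α n).continuous.measurable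
  fun_prop

lemma eps_lt {n : ℕ} {s : ℝ} (hs : 0 < s) (h : s < (n : ℝ) ^ 2) : ((n : ℝ) ^ 2)⁻¹ * s < 1 := by
  have : 0 < (n : ℝ) ^ 2 := hs.trans h
  rw [inv_mul_lt_iff₀ this]; linarith

lemma jf_nonneg (α b : ℝ) (n : ℕ) (s : ℝ) (hs : 0 < s) (h : s < (n : ℝ) ^ 2) : 0 ≤ jf α b n s := by
  have := eps_lt hs h
  have : 0 ≤ 1 - ((n : ℝ) ^ 2)⁻¹ * s := by linarith
  unfold jf; positivity

lemma tail_bound (α : ℝ) (hα : 0 < α) (b : ℝ) (hb : -1 < b) :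
    ∃ R0 > 0, ∃ C, 0 ≤ C ∧ ∀ n : ℕ, R0 < (n : ℝ) ^ 2 →
      IntegrableOn (jf α b n) (Set.Ioo R0 ((n : ℝ) ^ 2)) ∧
      ∫ s in Set.Ioo R0 ((n : ℝ) ^ 2), jf α b n s ≤ C := by
  obtain ⟨Cq, hCq⟩ := (isCompact_Icc (a := (0 : ℝ)) (b := 1)).exists_bound_of_continuousOn
    (f := jq α b) (by unfold jq; fun_prop)
  have hCq0 : 0 ≤ Cq := (norm_nonneg _).trans (hCq 0 (by simp))
  set c0 : ℝ := min 1 (1 + b) with hc0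
  have hc0p : 0 < c0 := lt_min one_pos (by linarith)
  have hc1 : c0 ≤ 1 := min_le_left _ _
  have hc2 : c0 ≤ 1 + b := min_le_right _ _
  set R0 : ℝ := 2 * Cq / c0 + 1 with hR0
  have hR0p : 0 < R0 := by positivity
  have hR0c : Cq ≤ c0 / 2 * R0 := by
    rw [hR0]; field_simp; nlinarith
  set M1 : ℝ := 1 / Real.Gamma (α + 1) * Real.exp ((2 * α + 2) * R0)
  set M2 : ℝ := 1 / Real.Gamma (α + 1) * (2 * α + 2) * Real.exp ((2 * α + 2) * R0)
  obtain ⟨M, hM⟩ := ((isCompact_Icc (a := (0 : ℝ)) (b := 1)).prod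
    ((isCompact_Icc (a := (1 : ℝ)) (b := 1 + 2 * α)).prod
    ((isCompact_Icc (a := -M1) (b := M1)).prod
    (isCompact_Icc (a := -M2) (b := M2))))).exists_bound_of_continuousOn
    (f := fun p : ℝ × ℝ × ℝ × ℝ => jB α b p.1 p.2.1 R0 p.2.2.1 p.2.2.2)
    (by unfold jB; fun_prop)
  refine ⟨R0, hR0p, 2 / c0 * (R0 ^ (α - 1 - b / 2) * |M|), by positivity, ?_⟩
  intro n hn
  have hn2 : 0 < (n : ℝ) ^ 2 := hR0p.trans hn
  have hn0 : 0 < n := by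
    rcases Nat.eq_zero_or_pos n with h | h
    · simp [h] at hn2
    · exact h
  have hn1 : (1 : ℝ) ≤ n := by exact_mod_cast hn0
  set ε : ℝ := ((n : ℝ) ^ 2)⁻¹ with hε
  have hε0 : 0 < ε := by positivity
  have hε1 : ε ≤ 1 := inv_le_one_of_one_le₀ (by nlinarith)
  set Λ : ℝ := n * (n + 2 * α) / (n : ℝ) ^ 2 with hΛ
  have hΛe : Λ = 1 + 2 * α / n := by rw [hΛ]; field_simp
  have hΛ1 : 1 ≤ Λ := by rw [hΛe]; have : 0 ≤ 2 * α / n := by positivity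
                         linarith
  have hΛ2 : Λ ≤ 1 + 2 * α := by
    rw [hΛe]; have : 2 * α / n ≤ 2 * α := div_le_self (by positivity) hn1
    linarith
  set g : ℝ → ℝ := fun s => (jQ α n).eval s with hg
  set g1 : ℝ → ℝ := fun s => (jQ α n).derivative.eval s with hg1
  set g2 : ℝ → ℝ := fun s => (jQ α n).derivative.derivative.eval s with hg2
  set Φ : ℝ → ℝ := fun s => -(s ^ (α - 1 - b / 2) * (1 - ε * s) ^ α * jB α b ε Λ s (g s) (g1 s)) with hΦ
  set Φ' : ℝ → ℝ := fun s => s ^ (α - 1 - b / 2 - 1) * (1 - ε * s) ^ (α - 1) * g s ^ 2 *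
        (Λ * (1 + b * (1 - ε * s)) * s - jq α b (ε * s)) with hΦ'
  have hder : ∀ s ∈ Set.Ioo R0 ((n : ℝ) ^ 2), HasDerivAt Φ (Φ' s) s := by
    intro s hs
    have hs0 : 0 < s := hR0p.trans hs.1
    refine Phi_deriv α b ε Λ g g1 g2 s hs0 (eps_lt hs0 hs.2) ((jQ α n).hasDerivAt s)
      ((jQ α n).derivative.hasDerivAt s) ?_
    have := jQ_ode α hα n hn0 s
    rw [div_eq_inv_mul s] at this
    exact this
  have hge : ∀ s ∈ Set.Ioo R0 ((n : ℝ) ^ 2), c0 / 2 * jf α b n s ≤ Φ' s := by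
    intro s hs
    have hs0 : 0 < s := hR0p.trans hs.1
    have hx := eps_lt hs0 hs.2
    have hx0 : 0 < ε * s := by positivity
    have hq := hCq (ε * s) ⟨hx0.le, hx.le⟩
    rw [Real.norm_eq_abs] at hq
    have hq' := (abs_le.1 hq).2
    have e1 : s ^ (α - 1 - b / 2) = s ^ (α - 1 - b / 2 - 1) * s := by
      rw [← Real.rpow_add_one hs0.ne']; ring_nf
    have h3 : c0 ≤ 1 + b * (1 - ε * s) := by
      change ε * s < 1 at hx
      nlinarith
    have h4 : c0 * s ≤ Λ * (1 + b * (1 - ε * s)) * s := by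
      have : c0 ≤ Λ * (1 + b * (1 - ε * s)) := by nlinarith
      gcongr
    have h5 : c0 / 2 * R0 ≤ c0 / 2 * s := by
      have := hs.1.le
      gcongr
    have h6 : c0 / 2 * s ≤ Λ * (1 + b * (1 - ε * s)) * s - jq α b (ε * s) := by linarith
    have h7 : 0 ≤ s ^ (α - 1 - b / 2 - 1) * (1 - ε * s) ^ (α - 1) * g s ^ 2 := by
      have : 0 ≤ 1 - ε * s := by linarith [show ε * s < 1 from hx]
      positivity
    calc c0 / 2 * jf α b n s = s ^ (α - 1 - b / 2 - 1) * (1 - ε * s) ^ (α - 1) * g s ^ 2 * (c0 / 2 * s) := by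
          unfold jf; rw [e1]; simp only [hg, hε]; ring
      _ ≤ _ := mul_le_mul_of_nonneg_left h6 h7
  have hf0 : ∀ s ∈ Set.Ioo R0 ((n : ℝ) ^ 2), 0 ≤ jf α b n s := fun s hs =>
    jf_nonneg α b n s (hR0p.trans hs.1) hs.2
  have hcont : ContinuousOn Φ (Set.Icc R0 ((n : ℝ) ^ 2)) := by
    have c1 : ContinuousOn (fun s : ℝ => s ^ (α - 1 - b / 2)) (Set.Icc R0 ((n : ℝ) ^ 2)) :=
      continuousOn_id.rpow_const fun s hs => Or.inl (hR0p.trans_le hs.1).ne'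
    have c2 : ContinuousOn (fun s : ℝ => (1 - ε * s) ^ α) (Set.Icc R0 ((n : ℝ) ^ 2)) :=
      ContinuousOn.rpow_const (by fun_prop) fun s hs => Or.inr hα.le
    have cg : Continuous g := (jQ α n).continuous
    have cg1 : Continuous g1 := (jQ α n).derivative.continuous
    have c3 : Continuous fun s => jB α b ε Λ s (g s) (g1 s) := by unfold jB; fun_prop
    exact ((c1.mul c2).mul c3.continuousOn).neg
  have hΦi : IntegrableOn Φ' (Set.Ioc R0 ((n : ℝ) ^ 2)) :=
    intervalIntegral.integrableOn_deriv_of_nonneg hcont hder fun s hs =>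
      le_trans (mul_nonneg (by positivity) (hf0 s hs)) (hge s hs)
  have hΦI : ∫ s in Set.Ioo R0 ((n : ℝ) ^ 2), Φ' s = Φ ((n : ℝ) ^ 2) - Φ R0 := by
    rw [← integral_Ioc_eq_integral_Ioo, ← intervalIntegral.integral_of_le hn.le]
    exact intervalIntegral.integral_eq_sub_of_hasDerivAt_of_le hn.le hcont hder
      ((intervalIntegrable_iff_integrableOn_Ioc_of_le hn.le).2 hΦi)
  have hΦo : IntegrableOn Φ' (Set.Ioo R0 ((n : ℝ) ^ 2)) := hΦi.mono_set Set.Ioo_subset_Ioc_self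
  have hle : ∀ s ∈ Set.Ioo R0 ((n : ℝ) ^ 2), jf α b n s ≤ 2 / c0 * Φ' s := by
    intro s hs
    have := hge s hs
    have e : jf α b n s = 2 / c0 * (c0 / 2 * jf α b n s) := by field_simp
    rw [e]; gcongr
  have hfi : IntegrableOn (jf α b n) (Set.Ioo R0 ((n : ℝ) ^ 2)) := by
    refine Integrable.mono' (hΦo.const_mul (2 / c0)) (jf_meas α b n).aestronglyMeasurable ?_
    filter_upwards [ae_restrict_mem measurableSet_Ioo] with s hs
    rw [Real.norm_eq_abs, abs_of_nonneg (hf0 s hs)]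
    exact hle s hs
  refine ⟨hfi, ?_⟩
  calc _ ≤ ∫ s in Set.Ioo R0 ((n : ℝ) ^ 2), 2 / c0 * Φ' s :=
        setIntegral_mono_on hfi (hΦo.const_mul _) measurableSet_Ioo hle
    _ = 2 / c0 * (Φ ((n : ℝ) ^ 2) - Φ R0) := by rw [integral_const_mul, hΦI]
    _ ≤ _ := by
      have z : Φ ((n : ℝ) ^ 2) = 0 := by
        simp only [hΦ, hε]
        rw [inv_mul_cancel₀ hn2.ne', sub_self, Real.zero_rpow hα.ne']; simp
      rw [z]
      have hx := eps_lt hR0p hn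
      change ε * R0 < 1 at hx
      have hb1 := abs_le.1 (jQ_bound α hα n hn0 R0 R0 hR0p.le le_rfl)
      have hb2 := abs_le.1 (jQ_deriv_bound α hα n hn0 R0 hR0p.le)
      have hm := hM (ε, Λ, g R0, g1 R0) ⟨⟨hε0.le, hε1⟩, ⟨hΛ1, hΛ2⟩, hb1, hb2⟩
      have h8 : (1 - ε * R0) ^ α ≤ 1 :=
        Real.rpow_le_one (by linarith) (by have : 0 ≤ ε * R0 := by positivity
                                           linarith) hα.le
      have h9 : 0 ≤ (1 - ε * R0) ^ α := Real.rpow_nonneg (by linarith) _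
      gcongr
      simp only [hΦ, zero_sub, neg_neg]
      rw [mul_assoc]
      gcongr
      calc _ ≤ (1 - ε * R0) ^ α * |M| := by
            gcongr
            exact (le_abs_self _).trans (hm.trans (le_abs_self _))
        _ ≤ 1 * |M| := by gcongr
        _ = _ := one_mul _

/-- Extended integrand. -/
noncomputable def jF (α a : ℝ) (n : ℕ) : ℝ → ℝ :=
  (Set.Ioo 0 ((n : ℝ) ^ 2)).indicator (jf α a n)

lemma jF_nonneg (α a : ℝ) (n : ℕ) (s : ℝ) : 0 ≤ jF α a n s :=
  Set.indicator_nonneg (fun s hs => jf_nonneg α a n s hs.1 hs.2) s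

lemma jF_meas (α a : ℝ) (n : ℕ) : Measurable (jF α a n) :=
  (jf_meas α a n).indicator measurableSet_Ioo

lemma sq_tendsto : Tendsto (fun n : ℕ => (n : ℝ) ^ 2) atTop atTop :=
  (tendsto_pow_atTop two_ne_zero).comp tendsto_natCast_atTop_atTop

lemma jF_le (α : ℝ) (hα : 0 < α) (a R : ℝ) (hR : 0 < R) (n : ℕ) (hn : 2 * R < (n : ℝ) ^ 2) (s : ℝ)
    (hs : s ∈ Set.Ioc 0 R) :
    jF α a n s ≤ (1 / Real.Gamma (α + 1) * Real.exp ((2 * α + 2) * R)) ^ 2 *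
      (s ^ (α - 1 - a / 2) * 2) := by
  have hn2 : 0 < (n : ℝ) ^ 2 := by linarith
  have hn0 : 0 < n := by
    rcases Nat.eq_zero_or_pos n with h | h
    · simp [h] at hn2
    · exact h
  have hs0 : 0 < s := hs.1
  rw [jF, Set.indicator_of_mem (show s ∈ Set.Ioo 0 ((n : ℝ) ^ 2) from ⟨hs.1, by linarith [hs.2]⟩), jf]
  have h1 := jQ_bound α hα n hn0 s R hs.1.le hs.2
  have h2 : ((n : ℝ) ^ 2)⁻¹ * s ≤ 1 / 2 := by
    rw [inv_mul_le_iff₀ hn2]; linarith [hs.2]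
  have h3 : 0 ≤ ((n : ℝ) ^ 2)⁻¹ * s := by positivity
  have h4 : (1 - ((n : ℝ) ^ 2)⁻¹ * s) ^ (α - 1) ≤ 2 := by
    calc _ ≤ (1 - ((n : ℝ) ^ 2)⁻¹ * s) ^ (-1 : ℝ) :=
          Real.rpow_le_rpow_of_exponent_ge (by linarith) (by linarith) (by linarith)
      _ ≤ 2 := by
          rw [Real.rpow_neg_one, inv_le_comm₀ (by linarith) (by norm_num)]; linarith
  have h5 : (jQ α n).eval s ^ 2 ≤ (1 / Real.Gamma (α + 1) * Real.exp ((2 * α + 2) * R)) ^ 2 := by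
    rw [← sq_abs]; gcongr
  have h6 : 0 ≤ (1 - ((n : ℝ) ^ 2)⁻¹ * s) ^ (α - 1) := Real.rpow_nonneg (by linarith) _
  gcongr

lemma bound_int (α a : ℝ) (had : a < 2 * α) (R K : ℝ) (hR : 0 < R) :
    IntegrableOn (fun s : ℝ => K * (s ^ (α - 1 - a / 2) * 2)) (Set.Ioc 0 R) := by
  have := intervalIntegral.intervalIntegrable_rpow' (a := 0) (b := R) (r := α - 1 - a / 2) (by linarith)
  rw [intervalIntegrable_iff_integrableOn_Ioc_of_le hR.le] at this
  exact (this.mul_const 2).const_mul K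

lemma jF_tendsto (α : ℝ) (hα : 0 < α) (a s : ℝ) (hs : 0 < s) :
    Tendsto (fun n => jF α a n s) atTop (nhds (jG α s ^ 2 * s ^ (α - 1 - a / 2))) := by
  have h1 := jQ_tendsto α hα s hs.le
  have h2 : Tendsto (fun n : ℕ => (1 - ((n : ℝ) ^ 2)⁻¹ * s) ^ (α - 1)) atTop (nhds 1) := by
    have : Tendsto (fun n : ℕ => (1 - ((n : ℝ) ^ 2)⁻¹ * s)) atTop (nhds (1 - 0 * s)) :=
      tendsto_const_nhds.sub ((tendsto_inv_atTop_zero.comp sq_tendsto).mul_const s)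
    rw [zero_mul, sub_zero] at this
    simpa using this.rpow_const (p := α - 1) (Or.inl one_ne_zero)
  have h3 := (h1.pow 2).mul (h2.const_mul (s ^ (α - 1 - a / 2)))
  rw [mul_one] at h3
  refine h3.congr' ?_
  filter_upwards [sq_tendsto.eventually_gt_atTop s] with n hn
  rw [jF, Set.indicator_of_mem (show s ∈ Set.Ioo 0 ((n : ℝ) ^ 2) from ⟨hs, hn⟩), jf]

lemma scaled_limit (α : ℝ) (hα : 0 < α) (a : ℝ) (ha : -1 < a) (had : a < 2 * α) :
    IntegrableOn (fun s => jG α s ^ 2 * s ^ (α - 1 - a / 2)) (Set.Ioi 0) ∧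
      Tendsto (fun n => ∫ s in Set.Ioi 0, jF α a n s) atTop
        (nhds (∫ s in Set.Ioi 0, jG α s ^ 2 * s ^ (α - 1 - a / 2))) := by
  have hFR : ∀ R, 0 < R → ∀ n : ℕ, 2 * R < (n : ℝ) ^ 2 → IntegrableOn (jF α a n) (Set.Ioc 0 R) := by
    intro R hR n hn
    refine Integrable.mono' (bound_int α a had R
      ((1 / Real.Gamma (α + 1) * Real.exp ((2 * α + 2) * R)) ^ 2) hR) (jF_meas α a n).aestronglyMeasurable ?_
    filter_upwards [ae_restrict_mem measurableSet_Ioc] with s hs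
    rw [Real.norm_eq_abs, abs_of_nonneg (jF_nonneg α a n s)]
    exact jF_le α hα a R hR n hn s hs
  have hind : ∀ (b R : ℝ) (n : ℕ), 0 < R → Set.EqOn (jF α b n)
      ((Set.Ioo R ((n : ℝ) ^ 2)).indicator (jf α b n)) (Set.Ioi R) := by
    intro b R n hR s hs
    have hs' : R < s := hs
    by_cases h : s < (n : ℝ) ^ 2
    · rw [jF, Set.indicator_of_mem (show s ∈ Set.Ioo 0 ((n : ℝ) ^ 2) from ⟨hR.trans hs', h⟩),
        Set.indicator_of_mem (show s ∈ Set.Ioo R ((n : ℝ) ^ 2) from ⟨hs', h⟩)]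
    · rw [jF, Set.indicator_of_notMem fun h' => h h'.2, Set.indicator_of_notMem fun h' => h h'.2]
  have hinter : ∀ R x : ℝ, Set.Ioi R ∩ Set.Ioo R x = Set.Ioo R x := fun R x =>
    Set.inter_eq_right.2 Set.Ioo_subset_Ioi_self
  refine lim_core (jF α a) _ (fun n s _ => jF_nonneg α a n s)
    (fun s hs => mul_nonneg (sq_nonneg _) (Real.rpow_nonneg hs.le _)) ?_ ?_ ?_ ?_
  · obtain ⟨R0, hR0, C, hC, h⟩ := tail_bound α hα a ha
    filter_upwards [sq_tendsto.eventually_gt_atTop (2 * R0)] with n hn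
    rw [← Set.Ioc_union_Ioi_eq_Ioi hR0.le]
    refine (hFR R0 hR0 n hn).union ?_
    rw [integrableOn_congr_fun (hind a R0 n hR0) measurableSet_Ioi]
    exact ((integrable_indicator_iff measurableSet_Ioo).2 (h n (by linarith)).1).integrableOn
  · intro R hR
    refine Integrable.mono' (bound_int α a had R ((1 / Real.Gamma (α + 1) * Real.exp ((2 * α + 2) * R)) ^ 2) hR) (aestronglyMeasurable_of_tendsto_ae atTop
      (fun n => (jF_meas α a n).aestronglyMeasurable) ?_) ?_
    · filter_upwards [ae_restrict_mem measurableSet_Ioc] with s hs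
      exact jF_tendsto α hα a s hs.1
    · filter_upwards [ae_restrict_mem measurableSet_Ioc] with s hs
      rw [Real.norm_eq_abs, abs_of_nonneg (mul_nonneg (sq_nonneg _) (Real.rpow_nonneg hs.1.le _))]
      refine le_of_tendsto (jF_tendsto α hα a s hs.1) ?_
      filter_upwards [sq_tendsto.eventually_gt_atTop (2 * R)] with n hn
      exact jF_le α hα a R hR n hn s hs
  · intro R hR
    refine tendsto_integral_filter_of_dominated_convergence _
      (Eventually.of_forall fun n => (jF_meas α a n).aestronglyMeasurable) ?_
      (bound_int α a had R ((1 / Real.Gamma (α + 1) * Real.exp ((2 * α + 2) * R)) ^ 2) hR) ?_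
    · filter_upwards [sq_tendsto.eventually_gt_atTop (2 * R)] with n hn
      filter_upwards [ae_restrict_mem measurableSet_Ioc] with s hs
      rw [Real.norm_eq_abs, abs_of_nonneg (jF_nonneg α a n s)]
      exact jF_le α hα a R hR n hn s hs
    · filter_upwards [ae_restrict_mem measurableSet_Ioc] with s hs
      exact jF_tendsto α hα a s hs.1
  · intro δ hδ
    set b : ℝ := (a - 1) / 2 with hb
    obtain ⟨R0, hR0, C, hC, h⟩ := tail_bound α hα b (by linarith)
    have ht : Tendsto (fun R : ℝ => R ^ (-((a - b) / 2)) * C) atTop (nhds (0 * C)) :=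
      (tendsto_rpow_neg_atTop (by linarith)).mul_const C
    rw [zero_mul] at ht
    obtain ⟨R1, hR1⟩ := eventually_atTop.1 (ht.eventually (gt_mem_nhds hδ))
    refine ⟨max R0 R1, lt_max_of_lt_left hR0, fun R hR => ?_⟩
    have hRR0 : R0 ≤ R := (le_max_left _ _).trans hR
    have hRp : 0 < R := hR0.trans_le hRR0
    filter_upwards [sq_tendsto.eventually_gt_atTop R] with n hn
    obtain ⟨hi, hle⟩ := h n (by linarith)
    have hsub : Set.Ioo R ((n : ℝ) ^ 2) ⊆ Set.Ioo R0 ((n : ℝ) ^ 2) := Set.Ioo_subset_Ioo_left hRR0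
    rw [setIntegral_congr_fun measurableSet_Ioi (hind a R n hRp),
      setIntegral_indicator measurableSet_Ioo, hinter]
    calc _ ≤ ∫ s in Set.Ioo R ((n : ℝ) ^ 2), R ^ (-((a - b) / 2)) * jf α b n s := by
          refine integral_mono_of_nonneg ?_ ((hi.mono_set hsub).const_mul _) ?_
          · filter_upwards [ae_restrict_mem measurableSet_Ioo] with s hs
            exact jf_nonneg α a n s (hRp.trans hs.1) hs.2
          · filter_upwards [ae_restrict_mem measurableSet_Ioo] with s hs
            have hs0 : 0 < s := hRp.trans hs.1
            have e : s ^ (α - 1 - a / 2) = s ^ (-((a - b) / 2)) * s ^ (α - 1 - b / 2) := by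
              rw [← Real.rpow_add hs0]; ring_nf
            have e2 : jf α a n s = s ^ (-((a - b) / 2)) * jf α b n s := by
              rw [jf, jf, e]; ring
            rw [e2]
            refine mul_le_mul_of_nonneg_right ?_ (jf_nonneg α b n s hs0 hs.2)
            exact Real.rpow_le_rpow_of_nonpos hRp hs.1.le (by linarith)
      _ = R ^ (-((a - b) / 2)) * ∫ s in Set.Ioo R ((n : ℝ) ^ 2), jf α b n s := integral_const_mul _ _
      _ ≤ R ^ (-((a - b) / 2)) * C := by
          gcongr
          refine le_trans (setIntegral_mono_set hi ?_ hsub.eventuallyLE) hle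
          filter_upwards [ae_restrict_mem measurableSet_Ioo] with s hs
          exact jf_nonneg α b n s (hR0.trans hs.1) hs.2
      _ ≤ δ := (hR1 R ((le_max_right _ _).trans hR)).le

lemma pref_tendsto (α : ℝ) (hα : 0 < α) :
    Tendsto (fun n : ℕ => Real.Gamma (α + n + 1) / n.factorial / (n : ℝ) ^ α) atTop (nhds 1) := by
  have hg : Real.Gamma α ≠ 0 := (Real.Gamma_pos_of_pos hα).ne'
  have h := (Real.GammaSeq_tendsto_Gamma α).inv₀ hg |>.const_mul (Real.Gamma α)
  rw [mul_inv_cancel₀ hg] at h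
  refine h.congr fun n => ?_
  have hp : ∀ k : ℕ, Real.Gamma (α + k) = (∏ j ∈ Finset.range k, (α + j)) * Real.Gamma α := by
    intro k
    induction k with
    | zero => simp
    | succ k ih =>
      rw [Finset.prod_range_succ, Nat.cast_succ, ← add_assoc, Real.Gamma_add_one (by positivity), ih]
      ring
  have := hp (n + 1)
  push_cast at this
  rw [add_assoc, this, Real.GammaSeq, inv_div]
  field_simp

lemma jacobi_eq (α : ℝ) (hα : 0 < α) (n : ℕ) (s : ℝ) :
    jacobiP α (α - 1) n (1 - 2 * ((n : ℝ) ^ 2)⁻¹ * s) =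
      Real.Gamma (α + n + 1) / n.factorial * (jQ α n).eval s := by
  rw [jacobiP, jQ_eval, Finset.mul_sum, Finset.mul_sum]
  refine Finset.sum_congr rfl fun m _ => ?_
  have e1 : α + (α - 1) + n + 1 = 2 * α + n := by ring
  have e2 : α + (α - 1) + n + m + 1 = 2 * α + n + m := by ring
  have e3 : (1 - 2 * ((n : ℝ) ^ 2)⁻¹ * s - 1) / 2 = (-1) * ((n : ℝ) ^ 2)⁻¹ * s := by ring
  rw [e1, e2, e3, mul_pow, mul_pow, inv_pow, ← pow_mul, jE]
  ring

lemma bessel_eq (α z : ℝ) (hz : 0 < z) :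
    besselJ α z = (z / 2) ^ α * jG α (z ^ 2 / 4) := by
  rw [besselJ, jG, ← tsum_mul_left]
  refine tsum_congr fun m => ?_
  have e : (z / 2) ^ (2 * (m : ℝ) + α) = (z / 2) ^ α * (z ^ 2 / 4) ^ m := by
    rw [Real.rpow_add (by positivity), mul_comm, Real.rpow_mul (by positivity), Real.rpow_natCast]
    congr 2
    rw [Real.rpow_two]; ring
  rw [e, show (m : ℝ) + α + 1 = α + m + 1 by ring]
  ring

lemma bessel_int (α a : ℝ)
    (h : IntegrableOn (fun s => jG α s ^ 2 * s ^ (α - 1 - a / 2)) (Set.Ioi 0)) :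
    IntegrableOn (fun t : ℝ => besselJ α t ^ 2 / t ^ (1 + a)) (Set.Ioi 0) ∧
    ∫ t in Set.Ioi (0 : ℝ), besselJ α t ^ 2 / t ^ (1 + a) =
      2 ^ (-1 - a) * ∫ s in Set.Ioi (0 : ℝ), jG α s ^ 2 * s ^ (α - 1 - a / 2) := by
  set G : ℝ → ℝ := fun s => jG α s ^ 2 * s ^ (α - 1 - a / 2) with hG
  have e : Set.EqOn (fun t : ℝ => besselJ α t ^ 2 / t ^ (1 + a))
      (fun t : ℝ => 2 ^ (-3 - a) * ((2 * t ^ ((2 : ℝ) - 1)) • (fun x => G (1 / 4 * x)) (t ^ (2 : ℝ))))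
      (Set.Ioi 0) := by
    intro t ht
    have ht : 0 < t := ht
    simp only [hG, smul_eq_mul, bessel_eq α t ht]
    have e1 : (1 / 4 * t ^ (2 : ℝ)) = t ^ 2 / 4 := by rw [Real.rpow_two]; ring
    have e2 : (t ^ 2 / 4) ^ (α - 1 - a / 2) = (t / 2) ^ (2 * α - 2 - a) := by
      rw [show t ^ 2 / 4 = (t / 2) ^ (2 : ℝ) by rw [Real.rpow_two]; ring,
        ← Real.rpow_mul (by positivity)]
      ring_nf
    have e3 : (2 : ℝ) * t ^ ((2 : ℝ) - 1) = 4 * (t / 2) := by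
      rw [show (2 : ℝ) - 1 = 1 by norm_num, Real.rpow_one]; ring
    have e4 : ((t / 2) ^ α) ^ 2 = (t / 2) ^ (2 * α - 2 - a) * (t / 2) * (t / 2) ^ (1 + a) := by
      rw [← Real.rpow_add_one (by positivity), ← Real.rpow_add (by positivity),
        ← Real.rpow_natCast, ← Real.rpow_mul (by positivity)]
      push_cast; ring_nf
    have e5 : t ^ (1 + a) = (t / 2) ^ (1 + a) * 2 ^ (1 + a) := by
      rw [← Real.mul_rpow (by positivity) (by positivity)]; congr 1; ring
    have e6 : (2 : ℝ) ^ (-3 - a) = 1 / (4 * 2 ^ (1 + a)) := by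
      rw [show -3 - a = -(2 + (1 + a)) by ring, Real.rpow_neg (by norm_num),
        Real.rpow_add (by norm_num), Real.rpow_two]
      norm_num
    rw [e1, e2, e3, mul_pow, e4, e5, e6]
    have p1 : (t / 2) ^ (1 + a) ≠ 0 := by positivity
    have p2 : (2 : ℝ) ^ (1 + a) ≠ 0 := by positivity
    field_simp
  have hi4 : IntegrableOn (fun x => G (1 / 4 * x)) (Set.Ioi 0) := by
    rw [integrableOn_Ioi_comp_mul_left_iff G 0 (by norm_num : (0 : ℝ) < 1 / 4)]
    simpa using h
  constructor
  · rw [integrableOn_congr_fun e measurableSet_Ioi]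
    have := (integrableOn_Ioi_comp_rpow_iff (fun x => G (1 / 4 * x)) (two_ne_zero (α := ℝ))).2 hi4
    rw [abs_of_pos (by norm_num : (0 : ℝ) < 2)] at this
    exact this.const_mul _
  · rw [setIntegral_congr_fun measurableSet_Ioi e, integral_const_mul,
      integral_comp_rpow_Ioi_of_pos (g := fun x => G (1 / 4 * x)) (by norm_num : (0 : ℝ) < 2)]
    have := integral_comp_mul_left_Ioi G 0 (by norm_num : (0 : ℝ) < 1 / 4)
    rw [this]
    have e6 : (2 : ℝ) ^ (-1 - a) = 2 ^ (-3 - a) * 4 := by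
      rw [show -1 - a = (-3 - a) + 2 by ring, Real.rpow_add (by norm_num), Real.rpow_two]
      norm_num
    rw [e6, mul_zero, smul_eq_mul]
    norm_num
    ring

lemma jacobi_int (α : ℝ) (hα : 0 < α) (a : ℝ) (n : ℕ) (hn : 0 < n) :
    (n : ℝ) ^ (-a) * ∫ t in Set.Ioo (-1 : ℝ) 1,
      jacobiP α (α - 1) n t ^ 2 * (1 - t) ^ (α - 1 - a / 2) * (1 + t) ^ (α - 1) =
    (Real.Gamma (α + n + 1) / n.factorial / (n : ℝ) ^ α) ^ 2 * 2 ^ (2 * α - 1 - a / 2) *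
      ∫ s in Set.Ioi 0, jF α a n s := by
  have hn' : (0 : ℝ) < n := by exact_mod_cast hn
  have hn2 : (0 : ℝ) < (n : ℝ) ^ 2 := by positivity
  set f : ℝ → ℝ := fun t => jacobiP α (α - 1) n t ^ 2 * (1 - t) ^ (α - 1 - a / 2) * (1 + t) ^ (α - 1)
    with hf
  have h1 := intervalIntegral.smul_integral_comp_sub_mul (a := 0) (b := (n : ℝ) ^ 2) f
    (2 * ((n : ℝ) ^ 2)⁻¹) 1
  rw [show 1 - 2 * ((n : ℝ) ^ 2)⁻¹ * (n : ℝ) ^ 2 = -1 by field_simp; norm_num,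
    show 1 - 2 * ((n : ℝ) ^ 2)⁻¹ * 0 = 1 by ring,
    intervalIntegral.integral_of_le (by norm_num : (-1 : ℝ) ≤ 1),
    intervalIntegral.integral_of_le hn2.le, integral_Ioc_eq_integral_Ioo,
    integral_Ioc_eq_integral_Ioo] at h1
  rw [← h1]
  have h2 : ∫ s in Set.Ioi 0, jF α a n s = ∫ s in Set.Ioo 0 ((n : ℝ) ^ 2), jf α a n s := by
    unfold jF
    rw [setIntegral_indicator measurableSet_Ioo, Set.inter_eq_right.2 Set.Ioo_subset_Ioi_self]
  rw [h2]
  set c : ℝ := (Real.Gamma (α + n + 1) / n.factorial) ^ 2 *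
    ((2 * ((n : ℝ) ^ 2)⁻¹) ^ (α - 1 - a / 2) * 2 ^ (α - 1)) with hc
  have h3 : Set.EqOn (fun s => f (1 - 2 * ((n : ℝ) ^ 2)⁻¹ * s)) (fun s => c * jf α a n s)
      (Set.Ioo 0 ((n : ℝ) ^ 2)) := by
    intro s hs
    have hx := eps_lt hs.1 hs.2
    simp only [hf, jacobi_eq α hα, jf, hc]
    rw [show 1 - (1 - 2 * ((n : ℝ) ^ 2)⁻¹ * s) = 2 * ((n : ℝ) ^ 2)⁻¹ * s by ring,
      show 1 + (1 - 2 * ((n : ℝ) ^ 2)⁻¹ * s) = 2 * (1 - ((n : ℝ) ^ 2)⁻¹ * s) by ring,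
      Real.mul_rpow (by positivity) hs.1.le,
      Real.mul_rpow (by norm_num : (0 : ℝ) ≤ 2) (by linarith : 0 ≤ 1 - ((n : ℝ) ^ 2)⁻¹ * s)]
    ring
  rw [setIntegral_congr_fun measurableSet_Ioo h3, integral_const_mul, smul_eq_mul, hc]
  have e1 : (2 * ((n : ℝ) ^ 2)⁻¹) ^ (α - 1 - a / 2) = 2 ^ (α - 1 - a / 2) * (n : ℝ) ^ (-2 * α + 2 + a) := by
    rw [Real.mul_rpow (by norm_num) (by positivity), ← Real.rpow_two, ← Real.rpow_neg hn'.le,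
      ← Real.rpow_mul hn'.le]
    ring_nf
  have e2 : (n : ℝ) ^ (-2 * α + 2 + a) = (((n : ℝ) ^ α) ^ 2)⁻¹ * (n : ℝ) ^ 2 * (n : ℝ) ^ a := by
    rw [Real.rpow_add hn', Real.rpow_add hn', Real.rpow_two]
    congr 2
    rw [← Real.rpow_natCast ((n : ℝ) ^ α), ← Real.rpow_mul hn'.le, ← Real.rpow_neg hn'.le]
    push_cast; ring_nf
  have e3 : (2 : ℝ) ^ (2 * α - 1 - a / 2) = 2 ^ (α - 1 - a / 2) * 2 ^ (α - 1) * 2 := by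
    rw [← Real.rpow_add (by norm_num), ← Real.rpow_add_one (by norm_num)]; ring_nf
  rw [e1, e2, e3, Real.rpow_neg hn'.le]
  have p1 : (n : ℝ) ^ a ≠ 0 := by positivity
  have p2 : (n : ℝ) ^ α ≠ 0 := by positivity
  field_simp

theorem jacobi_integral_limit (d : ℕ) (hd : 0 < d) (a : ℝ) (ha : -1 < a) (had : a < d)
    (lam : ℝ) (hlam : lam = ((d : ℝ) - 2) / 2) :
    Tendsto (fun L : ℕ => (L : ℝ) ^ (-a) *
        ∫ t in Set.Ioo (-1 : ℝ) 1,
          jacobiP (1 + lam) lam L t ^ 2 * (1 - t) ^ (lam - a / 2) * (1 + t) ^ lam)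
      atTop
      (nhds (2 ^ (a / 2 + d) * ∫ t in Set.Ioi (0 : ℝ), besselJ (1 + lam) t ^ 2 / t ^ (1 + a))) ∧
    IntegrableOn (fun t : ℝ => besselJ (1 + lam) t ^ 2 / t ^ (1 + a)) (Set.Ioi 0) volume := by
  obtain ⟨α, hα⟩ : ∃ α : ℝ, α = d / 2 := ⟨_, rfl⟩
  have hd' : (0 : ℝ) < d := by exact_mod_cast hd
  have hα0 : 0 < α := by rw [hα]; positivity
  have hl : lam = α - 1 := by rw [hlam, hα]; ring
  have hl1 : 1 + lam = α := by rw [hl]; ring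
  have hd2 : (d : ℝ) = 2 * α := by rw [hα]; ring
  rw [hl1, hl, hd2]
  obtain ⟨hi, ht⟩ := scaled_limit α hα0 a ha (by linarith)
  obtain ⟨hbi, hbI⟩ := bessel_int α a hi
  refine ⟨?_, hbi⟩
  rw [hbI]
  have h := (((pref_tendsto α hα0).pow 2).mul_const (2 ^ (2 * α - 1 - a / 2))).mul ht
  have e : (1 : ℝ) ^ 2 * 2 ^ (2 * α - 1 - a / 2) *
      (∫ s in Set.Ioi 0, jG α s ^ 2 * s ^ (α - 1 - a / 2)) =
      2 ^ (a / 2 + 2 * α) * (2 ^ (-1 - a) * ∫ s in Set.Ioi 0, jG α s ^ 2 * s ^ (α - 1 - a / 2)) := by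
    rw [← mul_assoc, ← Real.rpow_add (by norm_num)]
    ring_nf
  rw [e] at h
  refine h.congr' ?_
  filter_upwards [eventually_gt_atTop 0] with n hn
  exact (jacobi_int α hα0 a n hn).symm
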